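/- Let m ∈ [0,1) and 0 ≤ k < 1, and set k₀ = (2m³ − 6m² + 9m − 6 + 2√((m−1)⁴(m² − 2m + 4)))/(4m³ − 21m² + 36m − 20) and k₁ = (m² − 4m + 4)/(m² − 8m + 8). Assume k₀ < k < 1 and k ≠ k₁. Let f ∈ 𝒜 satisfy Re(f(z)/z) > k for all z ∈ 𝔻 \ {0}. Then Re(z f'(z)/f(z)) > m for all z with |z| < r, where r = √((m²(1−k) − m(2 − 6k) − 4k + 4√((m−1)(k−1)k)) / (m²(1−k) − m(4 − 8k) − 8k + 4)). -/

import Mathlib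

open Complex Metric Set

noncomputable section

/-- The class 𝒜 : analytic functions on the unit disk normalized by f(0)=0, f'(0)=1. -/
def memA (f : ℂ → ℂ) : Prop :=
  DifferentiableOn ℂ f (ball (0 : ℂ) 1) ∧ f 0 = 0 ∧ deriv f 0 = 1

lemma sp_key (a u : ℂ) :
    Complex.normSq (1 - (starRingEnd ℂ) a * u) - Complex.normSq (u - a)
      = (1 - Complex.normSq a) * (1 - Complex.normSq u) := by
  simp only [Complex.normSq_apply, Complex.sub_re, Complex.sub_im, Complex.mul_re, Complex.mul_im,
    Complex.conj_re, Complex.conj_im, Complex.one_re, Complex.one_im]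
  ring

lemma sp_lt (a : ℂ) (ha : ‖a‖ < 1) : Complex.normSq a < 1 := by
  rw [Complex.normSq_eq_norm_sq]
  nlinarith [norm_nonneg a]

lemma sp_den (a u : ℂ) (ha : ‖a‖ < 1) (hu : ‖u‖ < 1) : 1 - (starRingEnd ℂ) a * u ≠ 0 := by
  intro h
  have h1 := sp_key a u
  rw [h] at h1
  have := Complex.normSq_nonneg (u - a)
  have := mul_pos (sub_pos.2 (sp_lt a ha)) (sub_pos.2 (sp_lt u hu))
  simp at h1
  linarith

lemma sp_mob (a u : ℂ) (ha : ‖a‖ < 1) (hu : ‖u‖ < 1) :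
    ‖(u - a) / (1 - (starRingEnd ℂ) a * u)‖ < 1 := by
  rw [norm_div, div_lt_one (norm_pos_iff.2 (sp_den a u ha hu))]
  have h1 := sp_key a u
  have := mul_pos (sub_pos.2 (sp_lt a ha)) (sub_pos.2 (sp_lt u hu))
  rw [Complex.normSq_eq_norm_sq, Complex.normSq_eq_norm_sq (u - a)] at h1
  apply lt_of_pow_lt_pow_left₀ 2 (norm_nonneg _)
  linarith

lemma sp_hasDeriv (a u : ℂ) (h : 1 - (starRingEnd ℂ) a * u ≠ 0) :
    HasDerivAt (fun v : ℂ => (v - a) / (1 - (starRingEnd ℂ) a * v))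
      ((1 - (starRingEnd ℂ) a * a) / (1 - (starRingEnd ℂ) a * u) ^ 2) u := by
  have h1 : HasDerivAt (fun v : ℂ => v - a) 1 u := (hasDerivAt_id u).sub_const a
  have h2 : HasDerivAt (fun v : ℂ => 1 - (starRingEnd ℂ) a * v) (-((starRingEnd ℂ) a * 1)) u :=
    ((hasDerivAt_id u).const_mul _).const_sub 1
  refine (h1.div h2 h).congr_deriv ?_
  congr 1
  ring

lemma conj_mul_self' (a : ℂ) : (starRingEnd ℂ) a * a = ((‖a‖ ^ 2 : ℝ) : ℂ) := by
  rw [← Complex.normSq_eq_conj_mul_self, Complex.normSq_eq_norm_sq]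

lemma sp_strict (φ : ℂ → ℂ) (hd : DifferentiableOn ℂ φ (ball (0 : ℂ) 1))
    (hm : ∀ z, ‖z‖ < 1 → ‖φ z‖ < 1) (a : ℂ) (ha : ‖a‖ < 1) :
    ‖deriv φ a‖ * (1 - ‖a‖ ^ 2) ≤ 1 - ‖φ a‖ ^ 2 := by
  have hb := hm a ha
  set b := φ a with hbdef
  let T : ℂ → ℂ := fun v => (v - (-a)) / (1 - (starRingEnd ℂ) (-a) * v)
  let M : ℂ → ℂ := fun v => (v - b) / (1 - (starRingEnd ℂ) b * v)
  have ha' : ‖-a‖ < 1 := by simpa using ha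
  have hT0 : T 0 = a := by simp [T]
  have hTd : ∀ v, ‖v‖ < 1 → HasDerivAt T
      ((1 - (starRingEnd ℂ) (-a) * (-a)) / (1 - (starRingEnd ℂ) (-a) * v) ^ 2) v :=
    fun v hv => sp_hasDeriv (-a) v (sp_den _ _ ha' hv)
  have hTm : ∀ v, ‖v‖ < 1 → ‖T v‖ < 1 := fun v hv => sp_mob _ _ ha' hv
  have hMd : ∀ v, ‖v‖ < 1 → HasDerivAt M
      ((1 - (starRingEnd ℂ) b * b) / (1 - (starRingEnd ℂ) b * v) ^ 2) v :=
    fun v hv => sp_hasDeriv b v (sp_den _ _ hb hv)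
  have hMm : ∀ v, ‖v‖ < 1 → ‖M v‖ < 1 := fun v hv => sp_mob _ _ hb hv
  have hφd : ∀ v, ‖v‖ < 1 → HasDerivAt φ (deriv φ v) v := fun v hv =>
    (hd.differentiableAt (isOpen_ball.mem_nhds (by simpa using hv))).hasDerivAt
  have hg : ∀ v, ‖v‖ < 1 → HasDerivAt (fun v => M (φ (T v)))
      ((1 - (starRingEnd ℂ) b * b) / (1 - (starRingEnd ℂ) b * (φ (T v))) ^ 2 *
        (deriv φ (T v) *
        ((1 - (starRingEnd ℂ) (-a) * (-a)) / (1 - (starRingEnd ℂ) (-a) * v) ^ 2))) v := by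
    intro v hv
    have h1 := (hφd (T v) (hTm v hv)).comp v (hTd v hv)
    exact (hMd (φ (T v)) (hm _ (hTm v hv))).comp v h1
  have hg0 : M (φ (T 0)) = 0 := by simp [hT0, M, ← hbdef]
  have key := Complex.norm_deriv_le_one_of_mapsTo_ball (f := fun v => M (φ (T v))) (c := 0)
    (R := 1) (fun v hv => (hg v (by simpa using hv)).differentiableAt.differentiableWithinAt)
    (by
      intro v hv
      have hv' : ‖v‖ < 1 := by simpa using hv
      simp only [hg0, mem_closedBall, dist_zero_right]
      exact (hMm _ (hm _ (hTm v hv'))).le) one_pos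
  rw [(hg 0 (by simp)).deriv, hT0, ← hbdef] at key
  have pb : (0:ℝ) < 1 - ‖b‖ ^ 2 := by nlinarith [norm_nonneg b]
  have pa : (0:ℝ) < 1 - ‖a‖ ^ 2 := by nlinarith [norm_nonneg a]
  have e1 : (1 : ℂ) - (starRingEnd ℂ) b * b = ((1 - ‖b‖ ^ 2 : ℝ) : ℂ) := by
    rw [conj_mul_self']; push_cast; ring
  have e2 : (1 : ℂ) - (starRingEnd ℂ) (-a) * (-a) = ((1 - ‖a‖ ^ 2 : ℝ) : ℂ) := by
    rw [conj_mul_self', norm_neg]; push_cast; ring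
  rw [e1, e2] at key
  simp only [mul_zero, sub_zero, one_pow, div_one, norm_mul, norm_div, norm_pow,
    Complex.norm_real, Real.norm_eq_abs, abs_of_pos pa, abs_of_pos pb] at key
  have : (1 - ‖b‖ ^ 2) / (1 - ‖b‖ ^ 2) ^ 2 = (1 - ‖b‖ ^ 2)⁻¹ := by field_simp
  rw [this, inv_mul_le_iff₀ pb] at key
  linarith

lemma sp_closed (φ : ℂ → ℂ) (hd : DifferentiableOn ℂ φ (ball (0 : ℂ) 1))
    (hm : ∀ z, ‖z‖ < 1 → ‖φ z‖ ≤ 1) (a : ℂ) (ha : ‖a‖ < 1) :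
    ‖deriv φ a‖ * (1 - ‖a‖ ^ 2) ≤ 1 - ‖φ a‖ ^ 2 := by
  have h1 : ∀ t : ℝ, t ∈ Ioo (0:ℝ) 1 →
      t * ‖deriv φ a‖ * (1 - ‖a‖ ^ 2) ≤ 1 - (t * ‖φ a‖) ^ 2 := by
    intro t ht
    have hda : DifferentiableAt ℂ φ a := hd.differentiableAt (isOpen_ball.mem_nhds (by simpa using ha))
    have := sp_strict (fun z => (t : ℂ) * φ z) (hd.const_mul _) (by
      intro z hz
      rw [norm_mul, Complex.norm_real, Real.norm_eq_abs, abs_of_pos ht.1]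
      nlinarith [hm z hz, ht.1, ht.2, norm_nonneg (φ z)]) a ha
    rw [deriv_const_mul _ hda, norm_mul, norm_mul, Complex.norm_real, Real.norm_eq_abs,
      abs_of_pos ht.1] at this
    exact this
  have hc : ContinuousWithinAt (fun t : ℝ => t * ‖deriv φ a‖ * (1 - ‖a‖ ^ 2)) (Ioo 0 1) 1 := by
    fun_prop
  have hc' : ContinuousWithinAt (fun t : ℝ => 1 - (t * ‖φ a‖) ^ 2) (Ioo 0 1) 1 := by
    fun_prop
  have := ContinuousWithinAt.closure_le (by rw [closure_Ioo (by norm_num)]; simp) hc hc' h1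
  simpa using this

lemma q_bound (q : ℂ → ℂ) (hd : DifferentiableOn ℂ q (ball (0 : ℂ) 1)) (h0 : q 0 = 1)
    (hre : ∀ z, ‖z‖ < 1 → 0 < (q z).re) (z : ℂ) (hz : ‖z‖ < 1) :
    ‖z * deriv q z - (q z ^ 2 - 1) / 2‖ * (2 * (1 - ‖z‖ ^ 2)) ≤
      ‖z‖ ^ 2 * ‖q z + 1‖ ^ 2 - ‖q z - 1‖ ^ 2 := by
  have hne : ∀ z, ‖z‖ < 1 → q z + 1 ≠ 0 := by
    intro z hz h
    have := congrArg Complex.re h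
    simp at this
    linarith [hre z hz]
  have hqd : ∀ v, ‖v‖ < 1 → HasDerivAt q (deriv q v) v := fun v hv =>
    (hd.differentiableAt (isOpen_ball.mem_nhds (by simpa using hv))).hasDerivAt
  let w : ℂ → ℂ := fun v => (q v - 1) / (q v + 1)
  have hwd : ∀ v, ‖v‖ < 1 → HasDerivAt w (2 * deriv q v / (q v + 1) ^ 2) v := by
    intro v hv
    refine (((hqd v hv).sub_const 1).div ((hqd v hv).add_const 1) (hne v hv)).congr_deriv ?_
    congr 1
    ring
  have hwdiff : DifferentiableOn ℂ w (ball 0 1) := fun v hv =>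
    (hwd v (by simpa using hv)).differentiableAt.differentiableWithinAt
  have hw0 : w 0 = 0 := by simp [w, h0]
  have hwm : MapsTo w (ball 0 1) (closedBall (w 0) 1) := by
    intro v hv
    have hv' : ‖v‖ < 1 := by simpa using hv
    rw [hw0, mem_closedBall, dist_zero_right]
    simp only [w]
    rw [norm_div, div_le_one (norm_pos_iff.2 (hne v hv'))]
    apply le_of_sq_le_sq _ (norm_nonneg _)
    rw [← Complex.normSq_eq_norm_sq, ← Complex.normSq_eq_norm_sq, Complex.normSq_apply,
      Complex.normSq_apply]
    simp
    nlinarith [hre v hv']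
  have hφd : DifferentiableOn ℂ (dslope w 0) (ball 0 1) :=
    (differentiableOn_dslope (ball_mem_nhds _ one_pos)).2 hwdiff
  have hφm : ∀ v, ‖v‖ < 1 → ‖dslope w 0 v‖ ≤ 1 := by
    intro v hv
    simpa using Complex.norm_dslope_le_div_of_mapsTo_ball hwdiff hwm (by simpa using hv)
  have hsp := sp_closed _ hφd hφm z hz
  have hw : ∀ v, w v = v * dslope w 0 v := by
    intro v
    have := sub_smul_dslope w 0 v
    simp [hw0] at this
    exact this.symm
  have hφz : HasDerivAt (dslope w 0) (deriv (dslope w 0) z) z :=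
    (hφd.differentiableAt (isOpen_ball.mem_nhds (by simpa using hz))).hasDerivAt
  have hw' : HasDerivAt w (1 * dslope w 0 z + z * deriv (dslope w 0) z) z := by
    have := (hasDerivAt_id z).mul hφz
    refine this.congr_of_eventuallyEq (Filter.Eventually.of_forall fun v => ?_)
    simpa using hw v
  have heq := (hwd z hz).unique hw'
  have hwz := hw z
  set φ := dslope w 0 z
  set φ' := deriv (dslope w 0) z
  have hn := hne z hz
  have hwz' : q z - 1 = z * φ * (q z + 1) := by
    rw [← hwz]; simp only [w]; field_simp
  have e1 : z * deriv q z - (q z ^ 2 - 1) / 2 = (q z + 1) ^ 2 / 2 * (z ^ 2 * φ') := by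
    have h2 : 2 * deriv q z = (1 * φ + z * φ') * (q z + 1) ^ 2 := by
      rw [← heq]; field_simp
    linear_combination (z / 2) * h2 - (q z + 1) / 2 * hwz'
  have e2 : ‖q z - 1‖ ^ 2 = ‖z‖ ^ 2 * ‖φ‖ ^ 2 * ‖q z + 1‖ ^ 2 := by
    rw [hwz', norm_mul, norm_mul]; ring
  rw [e1, e2]
  simp only [norm_mul, norm_div, norm_pow, Complex.norm_ofNat]
  have := mul_le_mul_of_nonneg_left hsp (by positivity : 0 ≤ ‖q z + 1‖ ^ 2 * ‖z‖ ^ 2)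
  linarith

lemma real_part (a κ x R c y u v : ℝ) (ha : 1 ≤ a) (hκ : 0 ≤ κ) (hxR : x ≤ R) (hR : 0 < R)
    (hB : 0 ≤ 2 * a * (x - κ) - 1 - R ^ 2 + 2 * κ * x - κ ^ 2)
    (hy : y ^ 2 = κ) (hu : u ^ 2 = κ + a) (hv : v ^ 2 = 1 - c) (hy0 : 0 ≤ y) (hyu : y ≤ u)
    (huv : u < y + v) :
    2 * (c - 1) * R ^ 2 < x * R ^ 2 - 2 * κ * R ^ 2 + (κ ^ 2 - 1) * x
      - (2 * a * (x - κ) - 1 - R ^ 2 + 2 * κ * x - κ ^ 2) * R := by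
  have h1 : R ^ 2 - 2 * (a + κ) * R + κ ^ 2 - 1 ≤ 0 := by
    nlinarith [mul_nonneg (by linarith : (0:ℝ) ≤ a + κ) (sub_nonneg.2 hxR),
      mul_nonneg (by linarith : (0:ℝ) ≤ a) hκ]
  have h2 : 0 ≤ (R - x) * -(R ^ 2 - 2 * (a + κ) * R + κ ^ 2 - 1) :=
    mul_nonneg (sub_nonneg.2 hxR) (by linarith)
  have h3 : 0 < R ^ 2 + κ * (κ + a) - (c - 1 + 2 * κ + a) * R := by
    have e : c - 1 + 2 * κ + a = u ^ 2 + y ^ 2 - v ^ 2 := by linarith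
    rw [e, ← hu, ← hy]
    have h4 : 0 < (v - (u - y)) * (v + (u - y)) := mul_pos (by linarith) (by linarith)
    nlinarith [sq_nonneg (R - y * u), mul_pos hR h4]
  nlinarith [mul_pos hR h3]

lemma rad_real (m k N : ℝ) (hm1 : m < 1) (hk0 : 0 ≤ k) (hk1 : k < 1)
    (hN0 : 0 ≤ N)
    (hN : N < (m ^ 2 * (1 - k) - m * (2 - 6 * k) - 4 * k +
          4 * Real.sqrt ((m - 1) * (k - 1) * k)) /
        (m ^ 2 * (1 - k) - m * (4 - 8 * k) - 8 * k + 4)) :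
    N < 1 ∧ 1 + N < (1 - m + 2 * (Real.sqrt (k / (1 - k)) * Real.sqrt (1 - m))) * (1 - N) := by
  have hk : 0 < 1 - k := by linarith
  set y := Real.sqrt (k / (1 - k)) with hy
  set v := Real.sqrt (1 - m) with hv
  have hy0 : 0 ≤ y := Real.sqrt_nonneg _
  have hv0 : 0 ≤ v := Real.sqrt_nonneg _
  have hy2 : y ^ 2 * (1 - k) = k := by
    rw [hy, Real.sq_sqrt (by positivity)]; field_simp
  have hv2 : v ^ 2 = 1 - m := Real.sq_sqrt (by linarith)
  have hs : Real.sqrt ((m - 1) * (k - 1) * k) = (1 - k) * (y * v) := by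
    have : (m - 1) * (k - 1) * k = ((1 - k) * (y * v)) ^ 2 := by
      calc (m - 1) * (k - 1) * k = (1 - m) * (1 - k) * k := by ring
        _ = v ^ 2 * (1 - k) * (y ^ 2 * (1 - k)) := by rw [hv2, hy2]
        _ = _ := by ring
    rw [this, Real.sqrt_sq (by positivity)]
  rw [hs] at hN
  set t := y * v with ht
  have ht0 : 0 ≤ t := mul_nonneg hy0 hv0
  have ht2 : t ^ 2 * (1 - k) = k * (1 - m) := by
    rw [ht, mul_pow, hv2]; linear_combination (1 - m) * hy2
  have e1 : m ^ 2 * (1 - k) - m * (2 - 6 * k) - 4 * k + 4 * ((1 - k) * t)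
      = (2 * t - m) * ((1 - k) * (2 - m - 2 * t)) := by
    linear_combination 4 * ht2
  have e2 : m ^ 2 * (1 - k) - m * (4 - 8 * k) - 8 * k + 4
      = (2 - m + 2 * t) * ((1 - k) * (2 - m - 2 * t)) := by
    linear_combination 4 * ht2
  rw [e1, e2] at hN
  have hne : (1 - k) * (2 - m - 2 * t) ≠ 0 := by
    intro h
    rw [h] at hN
    simp at hN
    linarith
  rw [mul_div_mul_right _ _ hne, lt_div_iff₀ (by linarith)] at hN
  have : N < 1 := by nlinarith
  exact ⟨this, by nlinarith⟩


/-- (second case of the radius theorem) if f ∈ 𝒜 with Re(f(z)/z) > k on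
𝔻 \ {0}, k₀ < k < 1, k ≠ k₁, then Re(zf'(z)/f(z)) > m for |z| < r, where
r = √((m²(1-k) - m(2-6k) - 4k + 4√((m-1)(k-1)k)) / (m²(1-k) - m(4-8k) - 8k + 4)).
Here zf'(z)/f(z) denotes the analytic extension with value 1 at z = 0. -/
theorem radius_second_case (m k : ℝ) (hm0 : 0 ≤ m) (hm1 : m < 1)
    (hk0 : 0 ≤ k) (hk1 : k < 1)
    (hkk0 : (2 * m ^ 3 - 6 * m ^ 2 + 9 * m - 6 +
        2 * Real.sqrt ((m - 1) ^ 4 * (m ^ 2 - 2 * m + 4))) /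
      (4 * m ^ 3 - 21 * m ^ 2 + 36 * m - 20) < k)
    (hkk1 : k ≠ (m ^ 2 - 4 * m + 4) / (m ^ 2 - 8 * m + 8))
    (f : ℂ → ℂ) (hf : memA f)
    (hre : ∀ z ∈ ball (0 : ℂ) 1, z ≠ 0 → k < (f z / z).re) :
    ∀ z : ℂ,
      ‖z‖ < Real.sqrt ((m ^ 2 * (1 - k) - m * (2 - 6 * k) - 4 * k +
          4 * Real.sqrt ((m - 1) * (k - 1) * k)) /
        (m ^ 2 * (1 - k) - m * (4 - 8 * k) - 8 * k + 4)) →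
      m < (if z = 0 then (1 : ℂ) else z * deriv f z / f z).re := by
  intro z hz
  obtain ⟨hfd, hf0, hf1⟩ := hf
  by_cases hz0 : z = 0
  · simp [hz0, hm1]
  rw [if_neg hz0]
  rw [Real.lt_sqrt (norm_nonneg _)] at hz
  obtain ⟨hN1, hN2⟩ := rad_real m k (‖z‖ ^ 2) hm1 hk0 hk1 (by positivity) hz
  have hz1 : ‖z‖ < 1 := by nlinarith [norm_nonneg z]
  have hk : 0 < 1 - k := by linarith
  have hkc : (1 - k : ℂ) ≠ 0 := by
    have : ((1 - k : ℝ) : ℂ) ≠ 0 := by exact_mod_cast hk.ne'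
    simpa using this
  -- the quotient
  have hpd : DifferentiableOn ℂ (dslope f 0) (ball 0 1) :=
    (differentiableOn_dslope (ball_mem_nhds _ one_pos)).2 hfd
  have hfp : ∀ v, f v = v * dslope f 0 v := by
    intro v
    have := sub_smul_dslope f 0 v
    simp [hf0] at this
    exact this.symm
  have hpre : ∀ v, ‖v‖ < 1 → k < (dslope f 0 v).re := by
    intro v hv
    by_cases hv0 : v = 0
    · rw [hv0, dslope_same, hf1]; simpa using hk1
    · have := hre v (by simpa using hv) hv0
      rwa [hfp v, mul_div_cancel_left₀ _ hv0] at this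
  set p := dslope f 0 with hp
  let q : ℂ → ℂ := fun v => (p v - k) / (1 - k)
  have hqre : ∀ v, (q v).re = ((p v).re - k) / (1 - k) := by
    intro v
    have : q v = (p v - (k : ℝ)) / ((1 - k : ℝ) : ℂ) := by simp [q]
    rw [this, Complex.div_ofReal_re]
    simp
  have hqd : DifferentiableOn ℂ q (ball 0 1) := (hpd.sub_const _).div_const _
  have hq := q_bound q hqd (by simp only [q, hp, dslope_same, hf1]; exact div_self hkc)
    (fun v hv => by rw [hqre]; exact div_pos (by linarith [hpre v hv]) hk) z hz1
  have hpz : HasDerivAt p (deriv p z) z :=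
    (hpd.differentiableAt (isOpen_ball.mem_nhds (by simpa using hz1))).hasDerivAt
  have hqz : deriv q z = deriv p z / (1 - k) := ((hpz.sub_const _).div_const _).deriv
  have hfz : deriv f z = p z + z * deriv p z := by
    have h1 := (hasDerivAt_id z).mul hpz
    have h2 : HasDerivAt f (1 * p z + z * deriv p z) z := by
      refine h1.congr_of_eventuallyEq (Filter.Eventually.of_forall fun v => ?_)
      simpa using hfp v
    rw [h2.deriv, one_mul]
  have hpne : p z ≠ 0 := by
    intro h
    have := hpre z hz1
    rw [h] at this
    simp at this
    linarith
  set κ : ℝ := k / (1 - k) with hκ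
  have hκ0 : 0 ≤ κ := by positivity
  have hqre0 : 0 < (q z).re := by rw [hqre]; exact div_pos (by linarith [hpre z hz1]) hk
  obtain ⟨s, hs⟩ : ∃ s, s = q z + κ := ⟨_, rfl⟩
  have hps : p z = (1 - k) * s := by
    rw [hs, hκ]; push_cast; simp only [q]; field_simp; ring
  have hsre : κ < s.re := by rw [hs]; simp; exact hqre0
  have hs0 : s ≠ 0 := by
    intro h; rw [h] at hsre; simp at hsre; linarith
  have hR : 0 < ‖s‖ := norm_pos_iff.2 hs0
  obtain ⟨E, hE⟩ : ∃ E, E = z * deriv q z - (q z ^ 2 - 1) / 2 := ⟨_, rfl⟩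
  have hexpr : z * deriv f z / f z = 1 + (E + ((s - κ) ^ 2 - 1) / 2) / s := by
    have e1 : E + ((s - κ) ^ 2 - 1) / 2 = z * deriv p z / (1 - k) := by
      rw [hE, hs, hqz]; ring
    rw [e1, hfz, hfp z, hps]
    field_simp
  rw [hexpr]
  rw [← hE] at hq
  have hqs : q z = s - κ := by rw [hs]; ring
  rw [hqs] at hq
  have n1 : ‖s‖ ^ 2 = s.re ^ 2 + s.im ^ 2 := by
    rw [← Complex.normSq_eq_norm_sq, Complex.normSq_apply]; ring
  have n2 : ‖s - κ + 1‖ ^ 2 = ‖s‖ ^ 2 - 2 * (κ - 1) * s.re + (κ - 1) ^ 2 := by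
    rw [n1, ← Complex.normSq_eq_norm_sq, Complex.normSq_apply]; simp; ring
  have n3 : ‖s - κ - 1‖ ^ 2 = ‖s‖ ^ 2 - 2 * (κ + 1) * s.re + (κ + 1) ^ 2 := by
    rw [n1, ← Complex.normSq_eq_norm_sq, Complex.normSq_apply]; simp; ring
  rw [n2, n3] at hq
  have hEs : -(‖E‖ * ‖s‖) ≤ (E * (starRingEnd ℂ) s).re := by
    have := Complex.abs_re_le_norm (E * (starRingEnd ℂ) s)
    rw [norm_mul, Complex.norm_conj] at this
    exact (abs_le.1 this).1
  have hre1 : ((E + ((s - κ) ^ 2 - 1) / 2) / s).re * ‖s‖ ^ 2 =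
      (E * (starRingEnd ℂ) s).re +
        (s.re * ‖s‖ ^ 2 - 2 * κ * ‖s‖ ^ 2 + (κ ^ 2 - 1) * s.re) / 2 := by
    have : (E + ((s - κ) ^ 2 - 1) / 2) / s * ((‖s‖ ^ 2 : ℝ) : ℂ) =
        (E + ((s - κ) ^ 2 - 1) / 2) * (starRingEnd ℂ) s := by
      rw [← conj_mul_self']; field_simp
    rw [← Complex.re_mul_ofReal, this, add_mul, Complex.add_re]
    congr 1
    have : ((s - κ) ^ 2 - 1) / 2 * (starRingEnd ℂ) s =
      (s * ((‖s‖ ^ 2 : ℝ) : ℂ) - ((2 * κ * ‖s‖ ^ 2 : ℝ) : ℂ) +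
        ((κ ^ 2 - 1 : ℝ) : ℂ) * (starRingEnd ℂ) s) * ((1 / 2 : ℝ) : ℂ) := by
      have := conj_mul_self' s
      push_cast at this ⊢
      linear_combination (s / 2 - κ) * this
    rw [this, Complex.re_mul_ofReal, Complex.add_re, Complex.sub_re, Complex.re_mul_ofReal,
      Complex.ofReal_re, Complex.re_ofReal_mul, Complex.conj_re]
    ring
  obtain ⟨a, haN⟩ : ∃ a, a = (1 + ‖z‖ ^ 2) / (1 - ‖z‖ ^ 2) := ⟨_, rfl⟩
  have hD : 0 < 1 - ‖z‖ ^ 2 := by linarith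
  have haD : a * (1 - ‖z‖ ^ 2) = 1 + ‖z‖ ^ 2 := by rw [haN]; field_simp
  have ha1 : 1 ≤ a := by
    rw [haN, le_div_iff₀ hD]; nlinarith [sq_nonneg ‖z‖]
  have haU : a < 1 - m + 2 * (Real.sqrt κ * Real.sqrt (1 - m)) := by
    rw [haN, div_lt_iff₀ hD]; exact hN2
  have hB : 2 * ‖E‖ ≤ 2 * a * (s.re - κ) - 1 - ‖s‖ ^ 2 + 2 * κ * s.re - κ ^ 2 := by
    apply le_of_mul_le_mul_right _ hD
    have : (2 * a * (s.re - κ) - 1 - ‖s‖ ^ 2 + 2 * κ * s.re - κ ^ 2) * (1 - ‖z‖ ^ 2)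
      = 2 * (1 + ‖z‖ ^ 2) * (s.re - κ) +
        (- 1 - ‖s‖ ^ 2 + 2 * κ * s.re - κ ^ 2) * (1 - ‖z‖ ^ 2) := by
      rw [← haD]; ring
    rw [this]
    linarith
  have hκs : Real.sqrt κ ^ 2 = κ := Real.sq_sqrt hκ0
  have hvs : Real.sqrt (1 - m) ^ 2 = 1 - m := Real.sq_sqrt (by linarith)
  have hfin := real_part a κ s.re ‖s‖ m (Real.sqrt κ) (Real.sqrt (κ + a)) (Real.sqrt (1 - m))
    ha1 hκ0 (Complex.re_le_norm s) hR (by linarith [norm_nonneg E]) hκs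
    (Real.sq_sqrt (by linarith)) hvs (Real.sqrt_nonneg _) (Real.sqrt_le_sqrt (by linarith))
    (by
      rw [Real.sqrt_lt' (by
        have := Real.sqrt_nonneg κ
        have : 0 < Real.sqrt (1 - m) := Real.sqrt_pos.2 (by linarith)
        linarith)]
      have hsq : (Real.sqrt κ + Real.sqrt (1 - m)) ^ 2 = Real.sqrt κ ^ 2 +
          Real.sqrt (1 - m) ^ 2 + 2 * (Real.sqrt κ * Real.sqrt (1 - m)) := by ring
      rw [hsq, hκs, hvs]
      linarith only [haU])
  have hfin2 : (m - 1) * ‖s‖ ^ 2 < ((E + ((s - κ) ^ 2 - 1) / 2) / s).re * ‖s‖ ^ 2 := by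
    rw [hre1]
    have hBR := mul_le_mul_of_nonneg_right hB hR.le
    linarith only [hBR, hEs, hfin]
  have := lt_of_mul_lt_mul_right hfin2 (by positivity)
  rw [Complex.add_re, Complex.one_re]
  linarith
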